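/- arXiv:0804.0947 — 2 statements merged into one kernel-verified Lean document; each statement's English description precedes it below -/
import Mathlib

section
/- Let n ≥ 2 and let W = H_n be the hyperoctahedral group, with sign character ε : W → kˣ given by ε(t,σ) = (−1)^{∑_i t_i}·sign(σ). Then the sign-isotypic subspace {f ∈ k[W] : w f w⁻¹ = ε(w) f for all w ∈ W} of the group algebra k[W] under the conjugation action has k-dimension equal to the number of partitions of n/2 if n is even, and is zero if n is odd. -/
/-- The action of the symmetric group on `Fin n → Multiplicative (ZMod 2)` by permuting
coordinates: `σ · t = t ∘ σ⁻¹`. -/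
def hyperPhi (n : ℕ) :
    Equiv.Perm (Fin n) →* MulAut (Fin n → Multiplicative (ZMod 2)) where
  toFun σ := MulEquiv.arrowCongr σ (MulEquiv.refl (Multiplicative (ZMod 2)))
  map_one' := by apply MulEquiv.ext; intro t; rfl
  map_mul' σ τ := by apply MulEquiv.ext; intro t; rfl

/-- The hyperoctahedral group `H_n = (Fin n → Multiplicative (ZMod 2)) ⋊ Perm (Fin n)`,
where `Perm (Fin n)` acts by permuting coordinates. -/
abbrev Hyper (n : ℕ) : Type :=
  (Fin n → Multiplicative (ZMod 2)) ⋊[hyperPhi n] Equiv.Perm (Fin n)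

/-- Conjugation by the group element `s`, as a `k`-linear endomorphism of the group algebra
`k[W]`: it sends `f` to `s * f * s⁻¹`. -/
noncomputable def adConj (k : Type*) [Field k] {W : Type*} [Group W] (s : W) :
    MonoidAlgebra k W →ₗ[k] MonoidAlgebra k W :=
  (LinearMap.mulRight k (MonoidAlgebra.of k W s⁻¹)).comp
    (LinearMap.mulLeft k (MonoidAlgebra.of k W s))

/-- The sign-isotypic subspace `{f ∈ k[W] : w f w⁻¹ = ε(w) f for all w ∈ W}` of the group
algebra `k[W]` for the conjugation action, where `ε : W → k` is a character. -/
noncomputable def signIsotypic (k : Type*) [Field k] (W : Type*) [Group W] (ε : W → k) :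
    Submodule k (MonoidAlgebra k W) :=
  ⨅ w : W, LinearMap.eqLocus (adConj k w) (ε w • LinearMap.id)

section SignIsotypic

variable {k : Type*} [Field k] {W : Type*} [Group W]

theorem adConj_coeff (s : W) (f : MonoidAlgebra k W) (x : W) :
    (adConj k s f).coeff x = f.coeff (s⁻¹ * x * s) := by
  simp only [adConj, LinearMap.comp_apply, LinearMap.mulLeft_apply, LinearMap.mulRight_apply,
    MonoidAlgebra.of_apply]
  rw [MonoidAlgebra.coeff_mul_single_eq_coeff_mul (m₂ := x * s) (H := by
      intro m _; rw [mul_inv_eq_iff_eq_mul]), mul_one,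
    MonoidAlgebra.coeff_single_mul_eq_mul_coeff (m₂ := s⁻¹ * x * s) (H := by
      intro m _; rw [mul_assoc, eq_inv_mul_iff_mul_eq]), one_mul]

theorem mem_signIsotypic_iff {ε : W → k} {f : MonoidAlgebra k W} :
    f ∈ signIsotypic k W ε ↔ ∀ w x, f.coeff (w⁻¹ * x * w) = ε w * f.coeff x := by
  simp only [signIsotypic, Submodule.mem_iInf, LinearMap.mem_eqLocus, ← adConj_coeff]
  refine forall_congr' fun w => ?_
  rw [← MonoidAlgebra.coeff_inj, Finsupp.ext_iff]
  simp

theorem coeff_conj_of_mem_signIsotypic {ε : W →* kˣ} {f : MonoidAlgebra k W}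
    (hf : f ∈ signIsotypic k W (fun w => (ε w : k))) (w x : W) :
    f.coeff (w * x * w⁻¹) = (ε w : k)⁻¹ * f.coeff x := by
  have := mem_signIsotypic_iff.1 hf w⁻¹ x
  simpa using this

theorem coeff_eq_zero_of_mem_signIsotypic {ε : W →* kˣ} {f : MonoidAlgebra k W}
    (hf : f ∈ signIsotypic k W (fun w => (ε w : k))) {x y : W} (hxy : Commute y x)
    (hy : ε y ≠ 1) : f.coeff x = 0 := by
  have h := mem_signIsotypic_iff.1 hf y x
  rw [mul_assoc, ← hxy.eq, inv_mul_cancel_left] at h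
  by_contra h0
  apply hy
  ext
  exact (mul_right_cancel₀ h0 (by rw [← h]; simp)).symm

/-- The sum of the translates of `r` under the conjugation action, twisted by `ε`. -/
noncomputable def twistedOrbitSum [Fintype W] (ε : W →* kˣ) (r : W) : MonoidAlgebra k W :=
  ∑ g : W, MonoidAlgebra.single (g * r * g⁻¹) ((ε g : k)⁻¹)

theorem twistedOrbitSum_coeff [Fintype W] [DecidableEq W] (ε : W →* kˣ) (r x : W) :
    (twistedOrbitSum ε r).coeff x =
      ∑ g : W, if g * r * g⁻¹ = x then ((ε g : k)⁻¹) else 0 := by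
  rw [twistedOrbitSum, MonoidAlgebra.coeff_sum, Finsupp.finsetSum_apply]
  exact Finset.sum_congr rfl fun g _ => by
    rw [MonoidAlgebra.coeff_single, Finsupp.single_apply]

theorem twistedOrbitSum_mem [Fintype W] (ε : W →* kˣ) (r : W) :
    twistedOrbitSum ε r ∈ signIsotypic k W (fun w => (ε w : k)) := by
  classical
  rw [mem_signIsotypic_iff]
  intro w x
  rw [twistedOrbitSum_coeff, twistedOrbitSum_coeff, Finset.mul_sum]
  refine Fintype.sum_equiv (Equiv.mulLeft w) _ _ fun g => ?_
  have : g * r * g⁻¹ = w⁻¹ * x * w ↔ w * g * r * (w * g)⁻¹ = x := by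
    constructor
    · intro h
      calc _ = w * (g * r * g⁻¹) * w⁻¹ := by group
        _ = x := by rw [h]; group
    · rintro rfl
      group
  simp [this, mul_comm]

theorem twistedOrbitSum_coeff_self_ne_zero [Fintype W] [CharZero k] (ε : W →* kˣ) (r : W)
    (hr : ∀ y, Commute y r → ε y = 1) : (twistedOrbitSum ε r).coeff r ≠ 0 := by
  classical
  have : ∀ g : W, (if g * r * g⁻¹ = r then ((ε g : k)⁻¹) else 0) =
      if g * r * g⁻¹ = r then 1 else 0 := by
    intro g
    split_ifs with h
    · rw [hr g (mul_inv_eq_iff_eq_mul.1 h)]; simp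
    · rfl
  rw [twistedOrbitSum_coeff, Finset.sum_congr rfl fun g _ => this g, Finset.sum_boole]
  rw [Nat.cast_ne_zero, Finset.card_ne_zero]
  exact ⟨1, by simp⟩

/-- If `r` is a family of representatives of the conjugacy classes of those elements on whose
centralizer `ε` is trivial, then the `ε`-isotypic subspace has the size of that family as its
dimension. -/
theorem finrank_signIsotypic [Finite W] [CharZero k] (ε : W →* kˣ) {ι : Type*} [Finite ι]
    (r : ι → W) (hr : ∀ i y, Commute y (r i) → ε y = 1)
    (hinj : ∀ i j, IsConj (r i) (r j) → i = j)
    (hsurj : ∀ x, (∀ y, Commute y x → ε y = 1) → ∃ i, IsConj (r i) x) :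
    Module.finrank k (signIsotypic k W (fun w => (ε w : k))) = Nat.card ι := by
  classical
  cases nonempty_fintype W
  cases nonempty_fintype ι
  let ev : signIsotypic k W (fun w => (ε w : k)) →ₗ[k] (ι → k) :=
    { toFun := fun f i => f.1.coeff (r i)
      map_add' := fun f g => by ext i; simp
      map_smul' := fun c f => by ext i; simp }
  have hevinj : Function.Injective ev := by
    rw [injective_iff_map_eq_zero]
    intro f hf
    ext x
    by_cases hx : ∀ y, Commute y x → ε y = 1
    · obtain ⟨i, hi⟩ := hsurj x hx
      obtain ⟨c, rfl⟩ := isConj_iff.1 hi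
      rw [coeff_conj_of_mem_signIsotypic f.2, show f.1.coeff (r i) = 0 from congrFun hf i]
      simp
    · push Not at hx
      obtain ⟨y, hy, hy1⟩ := hx
      rw [coeff_eq_zero_of_mem_signIsotypic f.2 hy hy1]
      simp
  have hevsurj : Function.Surjective ev := by
    intro φ
    refine ⟨∑ i, (φ i / (twistedOrbitSum ε (r i)).coeff (r i)) •
      (⟨twistedOrbitSum ε (r i), twistedOrbitSum_mem ε (r i)⟩ :
        signIsotypic k W (fun w => (ε w : k))), ?_⟩
    rw [map_sum]
    ext j
    rw [Finset.sum_apply, Finset.sum_eq_single j]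
    · simp [ev, div_mul_cancel₀ _ (twistedOrbitSum_coeff_self_ne_zero ε (r j) (hr j))]
    · intro i _ hij
      have : (twistedOrbitSum ε (r i)).coeff (r j) = 0 := by
        rw [twistedOrbitSum_coeff]
        refine Finset.sum_eq_zero fun g _ => if_neg fun h => hij ?_
        exact hinj i j (isConj_iff.2 ⟨g, h⟩)
      simp [ev, this]
    · simp
  rw [(LinearEquiv.ofBijective ev ⟨hevinj, hevsurj⟩).finrank_eq, Module.finrank_fintype_fun_eq_card,
    Nat.card_eq_fintype_card]

end SignIsotypic

namespace Equiv.Perm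

section CycleSet

variable {α : Type*} [Fintype α] [DecidableEq α]

/-- The orbit of `i` under `σ`, fixed points included. -/
def cycleSet (σ : Perm α) (i : α) : Finset α := Finset.univ.filter (σ.SameCycle i)

@[simp]
theorem mem_cycleSet {σ : Perm α} {i j : α} : j ∈ σ.cycleSet i ↔ σ.SameCycle i j := by
  simp [cycleSet]

theorem cycleSet_inv (σ : Perm α) (i : α) : σ⁻¹.cycleSet i = σ.cycleSet i := by
  ext; simp

theorem SameCycle.cycleSet_eq {σ : Perm α} {i j : α} (h : σ.SameCycle i j) :
    σ.cycleSet i = σ.cycleSet j := by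
  ext x
  simp only [mem_cycleSet]
  exact ⟨h.symm.trans, h.trans⟩

theorem isCycleOn_cycleSet (σ : Perm α) (i : α) : σ.IsCycleOn (σ.cycleSet i : Set α) := by
  refine ⟨⟨fun x hx => ?_, σ.injective.injOn, fun x hx => ⟨σ⁻¹ x, ?_, by simp⟩⟩, ?_⟩
  · simpa using hx
  · simpa using hx
  · intro x hx y hy
    simp only [Finset.mem_coe, mem_cycleSet] at hx hy
    exact hx.symm.trans hy

theorem prod_range_card_cycleSet {G : Type*} [CommMonoid G] (σ : Perm α) (i : α) (g : α → G) :
    ∏ j ∈ Finset.range (σ.cycleSet i).card, g ((σ ^ j) i) = ∏ x ∈ σ.cycleSet i, g x := by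
  have hi : i ∈ σ.cycleSet i := mem_cycleSet.2 SameCycle.rfl
  refine Finset.prod_bij (fun j _ => (σ ^ j) i) ?_ ?_ ?_ ?_
  · intro j _
    simp [SameCycle.rfl]
  · intro a ha b hb hab
    have h := ((σ.isCycleOn_cycleSet i).pow_apply_eq_pow_apply hi).1 hab
    exact Nat.ModEq.eq_of_lt_of_lt h (Finset.mem_range.1 ha) (Finset.mem_range.1 hb)
  · intro x hx
    obtain ⟨m, hm, rfl⟩ := (σ.isCycleOn_cycleSet i).exists_pow_eq hi hx
    exact ⟨m, Finset.mem_range.2 hm, rfl⟩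
  · simp

theorem prod_range_eq_of_pow_apply_eq {G : Type*} [CommMonoid G] (σ : Perm α) (g : α → G)
    (hg : ∀ i, ∏ x ∈ σ.cycleSet i, g x = 1) (i : α) {a b : ℕ} (hab : (σ ^ a) i = (σ ^ b) i) :
    ∏ j ∈ Finset.range a, g ((σ ^ j) i) = ∏ j ∈ Finset.range b, g ((σ ^ j) i) := by
  have hi : i ∈ σ.cycleSet i := mem_cycleSet.2 SameCycle.rfl
  have hper : ∀ m q, ∏ j ∈ Finset.range (m + (σ.cycleSet i).card * q), g ((σ ^ j) i) =
      ∏ j ∈ Finset.range m, g ((σ ^ j) i) := by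
    intro m q
    induction q with
    | zero => simp
    | succ q ih =>
      have hs : σ.cycleSet i =
          σ.cycleSet ((σ ^ (m + (σ.cycleSet i).card * q)) i) := SameCycle.cycleSet_eq (by simp [SameCycle.rfl])
      rw [Nat.mul_succ, ← add_assoc, Finset.prod_range_add, ih]
      conv_rhs => rw [← mul_one (∏ j ∈ Finset.range m, g ((σ ^ j) i))]
      congr 1
      rw [← hg ((σ ^ (m + (σ.cycleSet i).card * q)) i), ← prod_range_card_cycleSet, ← hs]
      refine Finset.prod_congr rfl fun j _ => ?_
      rw [← mul_apply, ← pow_add, add_comm]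
  have h := ((σ.isCycleOn_cycleSet i).pow_apply_eq_pow_apply hi).1 hab
  wlog hle : a ≤ b generalizing a b
  · exact (this hab.symm h.symm (le_of_not_ge hle)).symm
  obtain ⟨q, hq⟩ := (Nat.modEq_iff_dvd' hle).1 h
  obtain rfl : b = a + (σ.cycleSet i).card * q := by omega
  exact (hper a q).symm

/-- A function whose product over each orbit of `σ` is trivial is a coboundary. -/
theorem exists_apply_eq_mul_of_prod_cycleSet_eq_one {G : Type*} [CommMonoid G] (σ : Perm α)
    (g : α → G) (hg : ∀ i, ∏ x ∈ σ.cycleSet i, g x = 1) :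
    ∃ s : α → G, ∀ i, s (σ i) = g i * s i := by
  let r : α → α := fun i => (Quotient.mk (SameCycle.setoid σ) i).out
  have hr : ∀ i, σ.SameCycle (r i) i := fun i => Quotient.mk_out (s := SameCycle.setoid σ) i
  have hrσ : ∀ i, r (σ i) = r i := fun i =>
    congrArg Quotient.out (Quotient.sound (s := SameCycle.setoid σ)
      (show σ.SameCycle (σ i) i by simp [SameCycle.rfl]))
  have hex : ∀ i, ∃ m : ℕ, (σ ^ m) (r i) = i := fun i => by
    obtain ⟨m, -, hm⟩ := (σ.isCycleOn_cycleSet (r i)).exists_pow_eq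
      (mem_cycleSet.2 SameCycle.rfl) (mem_cycleSet.2 (hr i))
    exact ⟨m, hm⟩
  choose m hm using hex
  refine ⟨fun i => ∏ j ∈ Finset.range (m i), g ((σ ^ j) (r i)), fun i => ?_⟩
  dsimp only
  rw [hrσ, prod_range_eq_of_pow_apply_eq σ g hg (r i) (b := m i + 1), Finset.prod_range_succ, hm,
    mul_comm]
  rw [pow_succ', mul_apply, hm]
  conv_lhs => rw [← hrσ, hm]

theorem support_cycleOf_eq_cycleSet {σ : Perm α} {i : α} (hi : σ i ≠ i) :
    (σ.cycleOf i).support = σ.cycleSet i := by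
  ext x
  rw [mem_support_cycleOf_iff' hi, mem_cycleSet]

theorem mem_cycleType_iff_exists_card_cycleSet {σ : Perm α} {m : ℕ} :
    m ∈ σ.cycleType ↔ ∃ i, σ i ≠ i ∧ (σ.cycleSet i).card = m := by
  rw [cycleType_def, Multiset.mem_map]
  constructor
  · rintro ⟨c, hc, rfl⟩
    obtain ⟨i, hi⟩ := (mem_cycleFactorsFinset_iff.1 hc).1.nonempty_support
    have h := (eq_cycleOf_of_mem_cycleFactorsFinset_iff σ c hc i).2 hi
    have hi' : σ i ≠ i := mem_support.1 (mem_cycleFactorsFinset_support_le hc hi)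
    exact ⟨i, hi', by rw [← support_cycleOf_eq_cycleSet hi', ← h]; rfl⟩
  · rintro ⟨i, hi, rfl⟩
    exact ⟨σ.cycleOf i, cycleOf_mem_cycleFactorsFinset_iff.2 (mem_support.2 hi), by
      rw [← support_cycleOf_eq_cycleSet hi]; rfl⟩

theorem apply_ne_of_even_card_cycleSet {σ : Perm α} {i : α} (h : Even (σ.cycleSet i).card) :
    σ i ≠ i := by
  intro hi
  have : σ.cycleSet i = {i} := by
    ext x
    rw [mem_cycleSet, Finset.mem_singleton]
    constructor
    · intro hx
      exact (hx.eq_of_left hi).symm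
    · rintro rfl
      exact SameCycle.rfl
  simp [this] at h

/-- All orbits are even exactly when the cycle type has only even parts and covers everything. -/
theorem forall_even_card_cycleSet_iff {σ : Perm α} :
    (∀ i, Even (σ.cycleSet i).card) ↔
      σ.cycleType.sum = Fintype.card α ∧ ∀ m ∈ σ.cycleType, Even m := by
  have hsupp : σ.cycleType.sum = Fintype.card α ↔ ∀ i, σ i ≠ i := by
    rw [sum_cycleType, Finset.card_eq_iff_eq_univ, Finset.eq_univ_iff_forall]
    simp
  rw [hsupp]
  constructor
  · refine fun h => ⟨fun i => apply_ne_of_even_card_cycleSet (h i), fun m hm => ?_⟩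
    obtain ⟨i, -, rfl⟩ := mem_cycleType_iff_exists_card_cycleSet.1 hm
    exact h i
  · rintro ⟨h1, h2⟩ i
    exact h2 _ (mem_cycleType_iff_exists_card_cycleSet.2 ⟨i, h1 i, rfl⟩)

end CycleSet

end Equiv.Perm

namespace Hyper

open Equiv.Perm

variable {n : ℕ}

theorem mul_left_apply (x y : Hyper n) (i : Fin n) :
    (x * y).left i = x.left i * y.left (x.right⁻¹ i) := rfl

/-- The embedding of the group with two elements into the units of the integers. -/
def signOfZMod : Multiplicative (ZMod 2) →* ℤ where
  toFun a := (-1) ^ a.toAdd.val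
  map_one' := by decide
  map_mul' := by decide

theorem signOfZMod_ofAdd_one : signOfZMod (Multiplicative.ofAdd 1) = -1 := by decide

theorem signOfZMod_eq_neg_one_iff {a : Multiplicative (ZMod 2)} :
    signOfZMod a = -1 ↔ a = Multiplicative.ofAdd 1 := by
  revert a; decide

/-- The sign character of the hyperoctahedral group, with integer values. -/
def intSign (g : Hyper n) : ℤ := (∏ i, signOfZMod (g.left i)) * (sign g.right : ℤ)

theorem intSign_eq (g : Hyper n) :
    intSign g = (-1) ^ (∑ i : Fin n, (Multiplicative.toAdd (g.left i)).val) *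
      (sign g.right : ℤ) := by
  rw [intSign, ← Finset.prod_pow_eq_pow_sum]
  rfl

theorem intSign_eq_or (g : Hyper n) : intSign g = 1 ∨ intSign g = -1 := by
  rw [intSign_eq]
  rcases neg_one_pow_eq_or ℤ (∑ i : Fin n, (Multiplicative.toAdd (g.left i)).val) with h | h <;>
    rcases Int.units_eq_one_or (sign g.right) with h' | h' <;> simp [h, h']

/-- The signed permutation representation of the hyperoctahedral group. -/
noncomputable def toEnd (n : ℕ) : Hyper n →* Module.End ℝ (Fin n → ℝ) where
  toFun g :=
    { toFun := fun v i => (signOfZMod (g.left i) : ℝ) * v (g.right⁻¹ i)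
      map_add' := fun v w => by ext i; simp [mul_add]
      map_smul' := fun c v => by ext i; simp [mul_left_comm] }
  map_one' := by ext; simp
  map_mul' x y := by
    ext v i
    simp [mul_left_apply, mul_assoc]

theorem toEnd_apply (g : Hyper n) (v : Fin n → ℝ) (i : Fin n) :
    toEnd n g v i = (signOfZMod (g.left i) : ℝ) * v (g.right⁻¹ i) := rfl

theorem det_toEnd (g : Hyper n) : LinearMap.det (toEnd n g) = (intSign g : ℝ) := by
  have : toEnd n g = Matrix.toLin' (Matrix.diagonal (fun i => (signOfZMod (g.left i) : ℝ)) *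
      (g.right⁻¹).permMatrix ℝ) := by
    refine LinearMap.ext fun v => funext fun i => ?_
    rw [toEnd_apply, Matrix.toLin'_apply, ← Matrix.mulVec_mulVec, Matrix.mulVec_diagonal,
      Matrix.permMatrix_mulVec]
    rfl
  rw [this, LinearMap.det_toLin', Matrix.det_mul, Matrix.det_diagonal, Matrix.det_permutation,
    intSign, sign_inv]
  push_cast
  rfl

/-- All cycles of `x` have even length and carry an odd number of sign changes. -/
def IsNegEven (x : Hyper n) : Prop :=
  ∀ i, Even (x.right.cycleSet i).card ∧ ∏ j ∈ x.right.cycleSet i, x.left j = Multiplicative.ofAdd 1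

theorem pow_left_apply (x : Hyper n) (m : ℕ) (i : Fin n) :
    (x ^ m).left i = ∏ j ∈ Finset.range m, x.left ((x.right⁻¹ ^ j) i) := by
  induction m generalizing i with
  | zero => rfl
  | succ m ih =>
    rw [pow_succ', mul_left_apply, ih, Finset.prod_range_succ', mul_comm]
    rfl

theorem right_pow (x : Hyper n) (m : ℕ) : (x ^ m).right = x.right ^ m :=
  map_pow SemidirectProduct.rightHom x m

theorem IsNegEven.toEnd_pow_card {x : Hyper n} (hx : IsNegEven x) (v : Fin n → ℝ) (i : Fin n) :
    toEnd n (x ^ (x.right.cycleSet i).card) v i = - v i := by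
  rw [toEnd_apply, pow_left_apply, right_pow, ← cycleSet_inv, prod_range_card_cycleSet,
    cycleSet_inv, (hx i).2, signOfZMod_ofAdd_one, ← inv_pow, ← cycleSet_inv,
    (isCycleOn_cycleSet _ i).pow_card_apply (mem_cycleSet.2 SameCycle.rfl)]
  simp

/-- The complex structure commuting with the centralizer of `x`, which is `x ^ (l / 2)` on the
span of each cycle of length `l`. -/
noncomputable def complexStructure (x : Hyper n) : Module.End ℝ (Fin n → ℝ) where
  toFun v i := toEnd n (x ^ ((x.right.cycleSet i).card / 2)) v i
  map_add' v w := by ext i; simp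
  map_smul' c v := by ext i; simp

theorem complexStructure_apply (x : Hyper n) (v : Fin n → ℝ) (i : Fin n) :
    complexStructure x v i = toEnd n (x ^ ((x.right.cycleSet i).card / 2)) v i := rfl

theorem IsNegEven.complexStructure_mul_self {x : Hyper n} (hx : IsNegEven x) :
    complexStructure x * complexStructure x = -1 := by
  refine LinearMap.ext fun v => funext fun i => ?_
  have h : ∀ m, x.right.cycleSet (((x ^ m).right)⁻¹ i) = x.right.cycleSet i := fun m =>
    (SameCycle.cycleSet_eq ⟨-(m : ℤ), by rw [right_pow, zpow_neg, zpow_natCast]⟩).symm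
  have h2 : (x.right.cycleSet i).card / 2 + (x.right.cycleSet i).card / 2 =
      (x.right.cycleSet i).card := by
    obtain ⟨a, ha⟩ := (hx i).1
    omega
  calc (complexStructure x * complexStructure x) v i
      = toEnd n (x ^ ((x.right.cycleSet i).card / 2))
          (toEnd n (x ^ ((x.right.cycleSet i).card / 2)) v) i := by
        rw [Module.End.mul_apply, complexStructure_apply, toEnd_apply, complexStructure_apply, h,
          ← toEnd_apply]
    _ = (-1 : Module.End ℝ (Fin n → ℝ)) v i := by
        rw [← Module.End.mul_apply, ← map_mul, ← pow_add, h2, hx.toEnd_pow_card]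
        rfl

theorem card_cycleSet_of_commute {x y : Hyper n} (h : Commute y x) (i : Fin n) :
    (x.right.cycleSet (y.right⁻¹ i)).card = (x.right.cycleSet i).card := by
  have hr : y.right * x.right * y.right⁻¹ = x.right :=
    mul_inv_eq_iff_eq_mul.2 (congrArg SemidirectProduct.right h.eq)
  refine Finset.card_equiv y.right fun j => ?_
  rw [mem_cycleSet, mem_cycleSet]
  conv_rhs => rw [← hr]
  rw [sameCycle_conj]
  simp

theorem commute_complexStructure {x y : Hyper n} (h : Commute y x) :
    Commute (complexStructure x) (toEnd n y) := by
  refine LinearMap.ext fun v => funext fun i => ?_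
  rw [Module.End.mul_apply, Module.End.mul_apply, complexStructure_apply, toEnd_apply y,
    complexStructure_apply, card_cycleSet_of_commute h, ← toEnd_apply y, ← Module.End.mul_apply,
    ← Module.End.mul_apply, ← map_mul, ← map_mul, (h.pow_right _).eq]

/-- An endomorphism commuting with a complex structure has nonnegative determinant. -/
theorem det_nonneg_of_commute_complexStructure {V : Type*} [AddCommGroup V] [Module ℝ V]
    {J f : Module.End ℝ V} (hJ : J * J = -1) (hf : Commute J f) : 0 ≤ LinearMap.det f := by
  let φ := Complex.lift ⟨J, hJ⟩
  let _ : Module ℂ V := Module.compHom V φ.toRingHom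
  have hsmul : ∀ (z : ℂ) (v : V), z • v = φ z v := fun _ _ => rfl
  have hφ : ∀ z v, φ z v = z.re • v + z.im • J v := fun z v => by
    simp [φ, Complex.liftAux_apply]
  have : IsScalarTower ℝ ℂ V := ⟨fun r z v => by
    rw [hsmul, hsmul, map_smul, LinearMap.smul_apply]⟩
  let F : V →ₗ[ℂ] V :=
    { toFun := f
      map_add' := map_add f
      map_smul' := fun z v => by
        rw [RingHom.id_apply, hsmul, hsmul, hφ, hφ, map_add, map_smul, map_smul,
          ← Module.End.mul_apply, ← Module.End.mul_apply, hf.eq] }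
  have hF : F.restrictScalars ℝ = f := rfl
  rw [← hF, LinearMap.det_restrictScalars, Algebra.norm_complex_apply]
  exact Complex.normSq_nonneg _

theorem IsNegEven.intSign_eq_one {x y : Hyper n} (hx : IsNegEven x) (h : Commute y x) :
    intSign y = 1 := by
  have h0 := det_nonneg_of_commute_complexStructure hx.complexStructure_mul_self
    (commute_complexStructure h)
  rw [det_toEnd] at h0
  rcases intSign_eq_or y with h1 | h1
  · exact h1
  · rw [h1] at h0
    norm_num at h0

theorem isNegEven_of_forall_commute {x : Hyper n} (h : ∀ y, Commute y x → intSign y = 1) :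
    IsNegEven x := by
  intro i
  have hmem : ∀ j, x.right.SameCycle i (x.right⁻¹ j) ↔ x.right.SameCycle i j := fun j => by simp
  have heven : Even (x.right.cycleSet i).card := by
    let z : Hyper n :=
      ⟨fun j => if x.right.SameCycle i j then Multiplicative.ofAdd 1 else 1, 1⟩
    have hz : Commute z x := by
      refine SemidirectProduct.ext (funext fun j => ?_) ?_
      · rw [mul_left_apply, mul_left_apply, mul_comm]
        simp only [z, hmem, inv_one, one_apply]
      · simp [z]
    have h1 := h z hz
    simp only [intSign, z, apply_ite signOfZMod, signOfZMod_ofAdd_one, map_one, Units.val_one,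
      mul_one] at h1
    rw [Finset.prod_ite, Finset.prod_const, Finset.prod_const_one, mul_one] at h1
    exact (neg_one_pow_eq_one_iff_even (by norm_num)).1 h1
  refine ⟨heven, ?_⟩
  have hi := apply_ne_of_even_card_cycleSet heven
  let z : Hyper n :=
    ⟨fun j => if x.right.SameCycle i j then x.left j else 1, x.right.cycleOf i⟩
  have hz : Commute z x := by
    refine SemidirectProduct.ext (funext fun j => ?_) ?_
    · rw [mul_left_apply, mul_left_apply]
      simp only [z, hmem, cycleOf_inv]
      split_ifs with hj
      · rw [(sameCycle_inv.2 hj).cycleOf_apply]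
      · rw [cycleOf_apply_of_not_sameCycle (mt sameCycle_inv.1 hj), one_mul, mul_one]
    · exact self_mem_cycle_factors_commute
        (cycleOf_mem_cycleFactorsFinset_iff.2 (mem_support.2 hi))
  have h1 := h z hz
  simp only [intSign, z, apply_ite signOfZMod, map_one] at h1
  rw [(isCycle_cycleOf _ hi).sign, support_cycleOf_eq_cycleSet hi, heven.neg_one_pow,
    Finset.prod_ite, Finset.prod_const_one, mul_one, ← map_prod] at h1
  rw [← signOfZMod_eq_neg_one_iff]
  change signOfZMod (∏ j ∈ x.right.cycleSet i, x.left j) * _ = 1 at h1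
  simpa [neg_eq_iff_eq_neg] using h1

theorem isNegEven_iff {x : Hyper n} : IsNegEven x ↔ ∀ y, Commute y x → intSign y = 1 :=
  ⟨fun hx _ h => hx.intSign_eq_one h, isNegEven_of_forall_commute⟩

theorem intSign_conj (g y : Hyper n) : intSign (g * y * g⁻¹) = intSign y := by
  have h : LinearMap.det (toEnd n (g * y * g⁻¹)) = LinearMap.det (toEnd n y) := by
    rw [map_mul, map_mul, map_mul, map_mul, mul_right_comm, ← map_mul, ← map_mul (toEnd n),
      mul_inv_cancel, map_one, map_one, one_mul]
  rw [det_toEnd, det_toEnd] at h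
  exact_mod_cast h

theorem IsNegEven.conj {x : Hyper n} (hx : IsNegEven x) (g : Hyper n) :
    IsNegEven (g * x * g⁻¹) := by
  rw [isNegEven_iff] at hx ⊢
  intro y hy
  have h := hx (g⁻¹ * y * g) (by
    have := hy.conj g⁻¹
    simpa [mul_assoc] using this)
  simpa using (intSign_conj g⁻¹ y).symm.trans (by simpa using h)

theorem IsNegEven.isConj_of_right_eq {x y : Hyper n} (hx : IsNegEven x) (hy : IsNegEven y)
    (h : x.right = y.right) : IsConj x y := by
  obtain ⟨s, hs⟩ := exists_apply_eq_mul_of_prod_cycleSet_eq_one x.right⁻¹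
    (fun i => x.left i * (y.left i)⁻¹) fun i => by
      rw [cycleSet_inv, Finset.prod_mul_distrib, Finset.prod_inv_distrib, (hx i).2, h, (hy i).2,
        mul_inv_cancel]
  rw [isConj_iff]
  refine ⟨⟨s, 1⟩, mul_inv_eq_iff_eq_mul.2 (SemidirectProduct.ext (funext fun i => ?_) ?_)⟩
  · rw [mul_left_apply, mul_left_apply]
    simp only [inv_one, one_apply, ← h, hs]
    rw [mul_comm (x.left i), ← mul_assoc, mul_inv_cancel_left, mul_comm]
  · simp [h]

theorem IsNegEven.isConj_iff_cycleType_eq {x y : Hyper n} (hx : IsNegEven x) (hy : IsNegEven y) :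
    IsConj x y ↔ x.right.cycleType = y.right.cycleType := by
  rw [← Equiv.Perm.isConj_iff_cycleType_eq]
  refine ⟨fun h => SemidirectProduct.rightHom.map_isConj h, fun h => ?_⟩
  obtain ⟨τ, hτ⟩ := isConj_iff.1 h
  let g : Hyper n := SemidirectProduct.inr τ
  refine (isConj_iff.2 ⟨g, rfl⟩).trans ((hx.conj g).isConj_of_right_eq hy ?_)
  simpa [g] using hτ

theorem exists_isNegEven (σ : Equiv.Perm (Fin n)) (hσ : ∀ i, Even (σ.cycleSet i).card) :
    ∃ x : Hyper n, IsNegEven x ∧ x.right = σ := by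
  let r : Fin n → Fin n := fun i => (Quotient.mk (SameCycle.setoid σ) i).out
  have hr : ∀ i, σ.SameCycle (r i) i := fun i => Quotient.mk_out (s := SameCycle.setoid σ) i
  have hrr : ∀ {i j}, σ.SameCycle i j → r i = r j := fun h =>
    congrArg Quotient.out (Quotient.sound (s := SameCycle.setoid σ) h)
  refine ⟨⟨fun i => if r i = i then Multiplicative.ofAdd 1 else 1, σ⟩, fun i => ⟨hσ i, ?_⟩, rfl⟩
  dsimp only
  rw [Finset.prod_eq_single (r i), if_pos (hrr (hr i))]
  · intro j hj hji
    rw [mem_cycleSet] at hj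
    rw [if_neg]
    rw [← hrr hj]
    exact hji.symm
  · intro h
    exact absurd (mem_cycleSet.2 (hr i).symm) h

theorem IsNegEven.even {x : Hyper n} (hx : IsNegEven x) : Even n := by
  obtain ⟨h1, h2⟩ := forall_even_card_cycleSet_iff.1 fun i => (hx i).1
  rw [Fintype.card_fin] at h1
  rw [← h1, even_iff_two_dvd]
  exact Multiset.dvd_sum fun m hm => (h2 m hm).two_dvd

theorem exists_isNegEven_of_partition (hn : Even n) (p : Nat.Partition (n / 2)) :
    ∃ x : Hyper n, IsNegEven x ∧ x.right.cycleType = p.parts.map (2 * ·) := by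
  have hsum : (p.parts.map (2 * ·)).sum = n := by
    rw [Multiset.sum_map_mul_left, Multiset.map_id', p.parts_sum]
    exact Nat.two_mul_div_two_of_even hn
  obtain ⟨σ, hσ⟩ := (Equiv.Perm.exists_with_cycleType_iff (Fin n) (m := p.parts.map (2 * ·))).2
    ⟨by rw [hsum, Fintype.card_fin], fun a ha => by
      obtain ⟨b, hb, rfl⟩ := Multiset.mem_map.1 ha
      have := p.parts_pos hb
      omega⟩
  obtain ⟨x, hx, rfl⟩ := exists_isNegEven σ (forall_even_card_cycleSet_iff.2
    ⟨by rw [hσ, hsum, Fintype.card_fin], fun m hm => by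
      rw [hσ] at hm
      obtain ⟨b, -, rfl⟩ := Multiset.mem_map.1 hm
      exact even_two_mul b⟩)
  exact ⟨x, hx, hσ⟩

theorem IsNegEven.exists_partition {x : Hyper n} (hx : IsNegEven x) :
    ∃ p : Nat.Partition (n / 2), x.right.cycleType = p.parts.map (2 * ·) := by
  obtain ⟨h1, h2⟩ := forall_even_card_cycleSet_iff.1 fun i => (hx i).1
  rw [Fintype.card_fin] at h1
  have hmap : (x.right.cycleType.map (· / 2)).map (2 * ·) = x.right.cycleType := by
    rw [Multiset.map_map]
    conv_rhs => rw [← Multiset.map_id x.right.cycleType]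
    exact Multiset.map_congr rfl fun m hm => Nat.two_mul_div_two_of_even (h2 m hm)
  refine ⟨⟨x.right.cycleType.map (· / 2), fun {a} ha => ?_, ?_⟩, hmap.symm⟩
  · obtain ⟨b, hb, rfl⟩ := Multiset.mem_map.1 ha
    have := two_le_of_mem_cycleType hb
    omega
  · have h := congrArg Multiset.sum hmap
    rw [Multiset.sum_map_mul_left, Multiset.map_id', h1] at h
    omega

end Hyper

/-- Let `n ≥ 2` and let `W = H_n` be the hyperoctahedral group, with sign
character `ε(t,σ) = (−1)^{∑ᵢ tᵢ} · sign σ`.  Then the sign-isotypic subspace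
`{f ∈ k[W] : w f w⁻¹ = ε(w) f for all w ∈ W}` of the group algebra `k[W]` under the
conjugation action has `k`-dimension equal to the number of partitions of `n/2` if `n` is
even, and is zero if `n` is odd. -/
theorem dynkin_stmt10 (n : ℕ) (hn : 2 ≤ n) {k : Type*} [Field k] [CharZero k]
    (ε : Hyper n →* kˣ)
    (hε : ∀ g : Hyper n, (ε g : k) =
      (-1 : k) ^ (∑ i : Fin n, (Multiplicative.toAdd (g.left i)).val) *
        ((Equiv.Perm.sign g.right : ℤ) : k)) :
    (Even n → Module.finrank k (signIsotypic k (Hyper n) (fun w => (ε w : k))) =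
        Nat.card (Nat.Partition (n / 2))) ∧
    (¬ Even n → signIsotypic k (Hyper n) (fun w => (ε w : k)) = ⊥) := by
  have hε1 : ∀ g : Hyper n, ε g = 1 ↔ Hyper.intSign g = 1 := fun g => by
    have hg : (ε g : k) = (Hyper.intSign g : k) := by
      rw [hε, Hyper.intSign_eq]
      push_cast
      rfl
    rw [Units.ext_iff, hg, Units.val_one, ← Int.cast_one, Int.cast_inj]
  have hgood : ∀ x : Hyper n, (∀ y, Commute y x → ε y = 1) ↔ Hyper.IsNegEven x := fun x => by
    simp only [hε1, Hyper.isNegEven_iff]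
  have : Finite (Hyper n) := Finite.of_equiv _ SemidirectProduct.equivProd.symm
  constructor
  · intro h
    choose r hr hrc using Hyper.exists_isNegEven_of_partition h
    refine finrank_signIsotypic ε r (fun p => (hgood _).2 (hr p)) (fun p q hpq => ?_)
      fun x hx => ?_
    · rw [(hr p).isConj_iff_cycleType_eq (hr q), hrc, hrc] at hpq
      exact Nat.Partition.ext
        (Multiset.map_injective (fun a b hab => Nat.eq_of_mul_eq_mul_left two_pos hab) hpq)
    · obtain ⟨p, hp⟩ := ((hgood x).1 hx).exists_partition
      exact ⟨p, ((hr p).isConj_iff_cycleType_eq ((hgood x).1 hx)).2 (by rw [hrc, hp])⟩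
  · intro h
    rw [Submodule.eq_bot_iff]
    intro f hf
    rw [← MonoidAlgebra.coeff_eq_zero]
    ext x
    have hx := mt (fun hx => ((hgood x).1 hx).even) h
    push Not at hx
    obtain ⟨y, hy, hy1⟩ := hx
    exact coeff_eq_zero_of_mem_signIsotypic hf hy hy1
end

section
/- Let (W,S) be a Coxeter system with S finite and with connected Coxeter graph (W irreducible), and let 𝒫 be the collection of maximal elements among the proper subsets B ⊊ S whose induced Coxeter graph is connected. For each conjugacy class c of W choose a representative w_c. Then the images of the elements w_c in the quotient k[W] / (∑_{s∈S} k[W]^{Ad(s)} + ∑_{B∈𝒫} k[W_B]), as c ranges over the conjugacy classes such that ε is trivial on the centraliser C_W(w_c) and such that c ∩ W_B = ∅ for every B ∈ 𝒫, form a k-basis of this quotient. -/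
theorem adConj_of (k : Type*) [Field k] {W : Type*} [Group W] (s w : W) :
    adConj k s (MonoidAlgebra.of k W w) = MonoidAlgebra.of k W (s * w * s⁻¹) := by
  simp [adConj]

/-- The function on `W` supported on the conjugacy class of `r`, with value `ε g` at
`g * r * g⁻¹`; the value is independent of `g` when `ε` is trivial on the centraliser of `r`. -/
noncomputable def twistedClassFun {k : Type*} [Field k] {W : Type*} [Group W] (ε : W →* kˣ)
    (r w : W) : k :=
  open Classical in if h : ∃ g, g * r * g⁻¹ = w then (ε h.choose : k) else 0

section TwistedClassFun

variable {k : Type*} [Field k] {W : Type*} [Group W] {ε : W →* kˣ} {r : W}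

theorem twistedClassFun_of_not_isConj {w : W} (h : ¬ IsConj r w) :
    twistedClassFun ε r w = 0 := by
  rw [isConj_iff] at h
  rw [twistedClassFun, dif_neg h]

theorem twistedClassFun_conj_self (hr : ∀ z ∈ Subgroup.centralizer {r}, ε z = 1) (g : W) :
    twistedClassFun ε r (g * r * g⁻¹) = ε g := by
  have h : ∃ x, x * r * x⁻¹ = g * r * g⁻¹ := ⟨g, rfl⟩
  rw [twistedClassFun, dif_pos h]
  have hx := h.choose_spec
  generalize h.choose = x at hx
  have hz : g⁻¹ * x ∈ Subgroup.centralizer {r} := by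
    rw [Subgroup.mem_centralizer_singleton_iff]
    calc g⁻¹ * x * r = g⁻¹ * (x * r * x⁻¹) * x := by group
      _ = r * (g⁻¹ * x) := by rw [hx]; group
  have h1 := hr _ hz
  rw [map_mul, map_inv, inv_mul_eq_one] at h1
  rw [h1]

theorem twistedClassFun_conj (hr : ∀ z ∈ Subgroup.centralizer {r}, ε z = 1) (g w : W) :
    twistedClassFun ε r (g * w * g⁻¹) = ε g * twistedClassFun ε r w := by
  by_cases h : IsConj r w
  · obtain ⟨x, rfl⟩ := isConj_iff.1 h
    have hgx : g * (x * r * x⁻¹) * g⁻¹ = (g * x) * r * (g * x)⁻¹ := by group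
    rw [hgx, twistedClassFun_conj_self hr, twistedClassFun_conj_self hr, map_mul, Units.val_mul]
  · have h' : ¬ IsConj r (g * w * g⁻¹) := fun hc =>
      h (hc.trans (isConj_iff.2 ⟨g, rfl⟩ : IsConj w _).symm)
    rw [twistedClassFun_of_not_isConj h, twistedClassFun_of_not_isConj h', mul_zero]

end TwistedClassFun

/-- The linear form on `k[W]` extending `twistedClassFun`. -/
noncomputable def twistedClassForm {k : Type*} [Field k] {W : Type*} [Group W] (ε : W →* kˣ)
    (r : W) : MonoidAlgebra k W →ₗ[k] k :=
  (MonoidAlgebra.basis W k).constr k (twistedClassFun ε r)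

section TwistedClassForm

variable {k : Type*} [Field k] {W : Type*} [Group W] {ε : W →* kˣ} {r : W}

theorem twistedClassForm_of (w : W) :
    twistedClassForm ε r (MonoidAlgebra.of k W w) = twistedClassFun ε r w := by
  rw [twistedClassForm, MonoidAlgebra.of_apply, ← MonoidAlgebra.basis_apply]
  exact Module.Basis.constr_basis _ _ _ _

theorem twistedClassForm_adConj (hr : ∀ z ∈ Subgroup.centralizer {r}, ε z = 1) (s : W)
    (f : MonoidAlgebra k W) :
    twistedClassForm ε r (adConj k s f) = ε s * twistedClassForm ε r f := by
  have h : (twistedClassForm ε r).comp (adConj k s) = (ε s : k) • twistedClassForm ε r := by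
    refine (MonoidAlgebra.basis W k).ext fun w => ?_
    rw [MonoidAlgebra.basis_apply, ← MonoidAlgebra.of_apply]
    simp only [LinearMap.comp_apply, LinearMap.smul_apply, adConj_of, twistedClassForm_of,
      twistedClassFun_conj hr, smul_eq_mul]
  exact LinearMap.congr_fun h f

theorem twistedClassForm_eq_zero_of_adConj_eq [CharZero k]
    (hr : ∀ z ∈ Subgroup.centralizer {r}, ε z = 1) {s : W} (hs : ε s = -1)
    {f : MonoidAlgebra k W} (hf : adConj k s f = f) : twistedClassForm ε r f = 0 := by
  have h := twistedClassForm_adConj hr s f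
  rw [hf, hs, Units.val_neg, Units.val_one, neg_one_mul] at h
  exact self_eq_neg.1 h

end TwistedClassForm

/-- Modulo the invariants of the simple reflections, conjugation by `g` acts as `ε g`. -/
theorem CoxeterSystem.of_conj_sub_smul_mem {B W : Type*} [Group W] {M : CoxeterMatrix B}
    (cs : CoxeterSystem M W) {k : Type*} [Field k] {ε : W →* kˣ}
    (hε : ∀ i : B, ε (cs.simple i) = -1) {N : Submodule k (MonoidAlgebra k W)}
    (hN : ∀ i, LinearMap.eqLocus (adConj k (cs.simple i)) LinearMap.id ≤ N) (g w : W) :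
    MonoidAlgebra.of k W (g * w * g⁻¹) - (ε g : k) • MonoidAlgebra.of k W w ∈ N := by
  induction g using cs.simple_induction generalizing w with
  | simple i =>
    refine hN i ?_
    have hss : cs.simple i * (cs.simple i * w * (cs.simple i)⁻¹) * (cs.simple i)⁻¹ = w := by
      simp [mul_assoc]
    rw [hε, Units.val_neg, Units.val_one, neg_one_smul, sub_neg_eq_add, LinearMap.mem_eqLocus,
      LinearMap.id_apply, map_add, adConj_of, adConj_of, hss, add_comm]
  | one => simp
  | mul a b ha hb =>
    have h := N.add_mem (ha (b * w * b⁻¹)) (N.smul_mem (ε a : k) (hb w))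
    have hab : a * (b * w * b⁻¹) * a⁻¹ = a * b * w * (a * b)⁻¹ := by group
    rwa [hab, smul_sub, smul_smul, ← Units.val_mul, ← map_mul, sub_add_sub_cancel] at h


/-- Let `(W,S)` be an irreducible Coxeter system with `S` finite (connected
Coxeter graph `G`), and let `𝒫` be the collection of maximal elements among the proper
subsets `B ⊊ S` whose induced Coxeter graph is connected.  For each conjugacy class `c` of
`W` choose a representative `w_c`.  Then the images of the elements `w_c` in the quotient
`k[W] / (∑_{s∈S} k[W]^{Ad(s)} + ∑_{B∈𝒫} k[W_B])`, as `c` ranges over the conjugacy classes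
such that `ε` is trivial on the centraliser `C_W(w_c)` and such that `c ∩ W_B = ∅` for every
`B ∈ 𝒫`, form a `k`-basis of this quotient. -/
theorem dynkin_stmt13 {B W : Type*} [Group W] [Fintype B] {M : CoxeterMatrix B}
    (cs : CoxeterSystem M W) {k : Type*} [Field k] [CharZero k]
    (ε : W →* kˣ) (hε : ∀ i : B, ε (cs.simple i) = -1)
    (G : SimpleGraph B) (hG : ∀ i j : B, G.Adj i j ↔ i ≠ j ∧ M i j ≠ 2)
    (hconn : G.Connected)
    (P : Set (Set B))
    (hP : P = {B' : Set B | ((G.induce B').Connected ∧ B' ≠ Set.univ) ∧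
      ∀ B'' : Set B, (G.induce B'').Connected → B'' ≠ Set.univ → B' ⊆ B'' → B' = B''})
    (rep : ConjClasses W → W) (hrep : ∀ c, ConjClasses.mk (rep c) = c)
    (N : Submodule k (MonoidAlgebra k W))
    (hN : N = (⨆ i : B, LinearMap.eqLocus (adConj k (cs.simple i)) LinearMap.id) ⊔
      (⨆ B' ∈ P, Submodule.span k ((MonoidAlgebra.of k W) ''
        ((Subgroup.closure (cs.simple '' B') : Subgroup W) : Set W)))) :
    LinearIndependent k
      (fun c : {c : ConjClasses W //
          (∀ z ∈ Subgroup.centralizer {rep c}, ε z = 1) ∧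
          ∀ B' ∈ P, ∀ w ∈ Subgroup.closure (cs.simple '' B'), ConjClasses.mk w ≠ c} =>
        (Submodule.Quotient.mk (MonoidAlgebra.of k W (rep c.1)) :
          MonoidAlgebra k W ⧸ N)) ∧
    Submodule.span k
      (Set.range
        (fun c : {c : ConjClasses W //
            (∀ z ∈ Subgroup.centralizer {rep c}, ε z = 1) ∧
            ∀ B' ∈ P, ∀ w ∈ Subgroup.closure (cs.simple '' B'), ConjClasses.mk w ≠ c} =>
          (Submodule.Quotient.mk (MonoidAlgebra.of k W (rep c.1)) :
            MonoidAlgebra k W ⧸ N))) = ⊤ := by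
  have hinv : ∀ i, LinearMap.eqLocus (adConj k (cs.simple i)) LinearMap.id ≤ N := fun i => by
      rw [hN]
      exact le_sup_of_le_left (le_iSup
        (fun j => LinearMap.eqLocus (adConj k (cs.simple j)) LinearMap.id) i)
  have hpar : ∀ B' ∈ P, ∀ w ∈ Subgroup.closure (cs.simple '' B'), MonoidAlgebra.of k W w ∈ N :=
    fun B' hB' w hw => by
      rw [hN]
      exact Submodule.mem_sup_right (Submodule.mem_iSup_of_mem B'
        (Submodule.mem_iSup_of_mem hB' (Submodule.subset_span ⟨w, hw, rfl⟩)))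
  have hconj := cs.of_conj_sub_smul_mem hε hinv
  constructor
  · have hker : ∀ c : {c : ConjClasses W //
        (∀ z ∈ Subgroup.centralizer {rep c}, ε z = 1) ∧
        ∀ B' ∈ P, ∀ w ∈ Subgroup.closure (cs.simple '' B'), ConjClasses.mk w ≠ c},
        N ≤ LinearMap.ker (twistedClassForm ε (rep c.1)) := by
      rintro ⟨c, hc, hcP⟩
      rw [hN]
      refine sup_le (iSup_le fun i f hf => ?_) (iSup₂_le fun B' hB' => Submodule.span_le.2 ?_)
      · exact twistedClassForm_eq_zero_of_adConj_eq hc (hε i) hf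
      · rintro _ ⟨w, hw, rfl⟩
        rw [SetLike.mem_coe, LinearMap.mem_ker, twistedClassForm_of]
        refine twistedClassFun_of_not_isConj fun h => hcP B' hB' w hw ?_
        rw [← hrep c]
        exact ConjClasses.mk_eq_mk_iff_isConj.2 h.symm
    refine LinearIndependent.of_pairwise_dual_eq_zero_one _
      (fun c => N.liftQ (twistedClassForm ε (rep c.1)) (hker c)) (fun c d hcd => ?_) fun c => ?_
    · beta_reduce
      rw [Submodule.liftQ_apply, twistedClassForm_of]
      refine twistedClassFun_of_not_isConj fun h => hcd (Subtype.ext ?_)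
      rw [← hrep c.1, ← hrep d.1]
      exact ConjClasses.mk_eq_mk_iff_isConj.2 h
    · rw [Submodule.liftQ_apply, twistedClassForm_of]
      simpa using twistedClassFun_conj_self c.2.1 1
  · rw [eq_top_iff, ← Submodule.range_mkQ N, LinearMap.range_eq_map,
      ← (MonoidAlgebra.basis W k).span_eq, Submodule.map_span_le]
    rintro _ ⟨w, rfl⟩
    rw [MonoidAlgebra.basis_apply, ← MonoidAlgebra.of_apply]
    obtain ⟨g, hg⟩ := isConj_iff.1 (ConjClasses.mk_eq_mk_iff_isConj.1 (hrep (ConjClasses.mk w)))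
    have hw := hconj g (rep (ConjClasses.mk w))
    rw [hg] at hw
    rw [Submodule.mkQ_apply, (Submodule.Quotient.eq N).2 hw, Submodule.Quotient.mk_smul]
    refine Submodule.smul_mem _ _ ?_
    by_cases hc : (∀ z ∈ Subgroup.centralizer {rep (ConjClasses.mk w)}, ε z = 1) ∧
        ∀ B' ∈ P, ∀ v ∈ Subgroup.closure (cs.simple '' B'), ConjClasses.mk v ≠ ConjClasses.mk w
    · exact Submodule.subset_span ⟨⟨_, hc⟩, rfl⟩
    · suffices h : MonoidAlgebra.of k W (rep (ConjClasses.mk w)) ∈ N by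
        rw [(Submodule.Quotient.mk_eq_zero N).2 h]
        exact Submodule.zero_mem _
      rw [not_and_or] at hc
      push Not at hc
      rcases hc with ⟨z, hz, hz1⟩ | ⟨B', hB', v, hv, hvw⟩
      · have h := hconj z (rep (ConjClasses.mk w))
        rw [Subgroup.mem_centralizer_singleton_iff] at hz
        rw [hz, mul_inv_cancel_right] at h
        have h' : (1 - (ε z : k)) • MonoidAlgebra.of k W (rep (ConjClasses.mk w)) ∈ N := by
          rwa [sub_smul, one_smul]
        refine (N.smul_mem_iff (sub_ne_zero.2 fun h1 => hz1 ?_)).1 h'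
        exact Units.ext h1.symm
      · rw [← hrep (ConjClasses.mk w)] at hvw
        obtain ⟨x, hx⟩ := isConj_iff.1 (ConjClasses.mk_eq_mk_iff_isConj.1 hvw)
        have h := hconj x v
        rw [hx] at h
        exact (N.sub_mem_iff_left (N.smul_mem _ (hpar B' hB' v hv))).1 h
end
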